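/- arXiv:2501.01574 — 2 statements merged into one kernel-verified Lean document; each statement's English description precedes it below -/
import Mathlib

section
/- Let (μ_k)_{k∈ℕ} be a sequence of Borel probability measures on ℝ and h : [0,∞) → ℝ a continuous function such that for every λ ≥ 0 the function y ↦ e^{−λy} is integrable with respect to each μ_k and ∫_ℝ e^{−λy} dμ_k(y) → h(λ) as k → ∞. Then there exists a Borel probability measure μ on ℝ such that y ↦ e^{−λy} is μ-integrable with ∫_ℝ e^{−λy} dμ(y) = h(λ) for all λ ≥ 0, μ is the unique probability measure on ℝ with this property, and μ_k converges weakly to μ (i.e. ∫ f dμ_k → ∫ f dμ for every bounded continuous f : ℝ → ℝ). -/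
open MeasureTheory Filter

/-- Convexity of the exponential between `0` and `x`. -/
lemma Real.exp_mul_le_add_of_mem_Icc {l : ℝ} (h0 : 0 ≤ l) (h1 : l ≤ 1) (x : ℝ) :
    Real.exp (l * x) ≤ l * Real.exp x + (1 - l) := by
  have := convexOn_exp.2 (Set.mem_univ x) (Set.mem_univ 0) h0 (sub_nonneg.2 h1) (by ring)
  simpa using this

/-- Pointwise bound of the indicator of a tail set by Laplace kernels. -/
lemma indicator_lt_norm_le_exp {r : ℝ} (hr : 1 ≤ r) (y : ℝ) :
    Set.indicator {x : ℝ | r < ‖x‖} (fun _ => (1 : ℝ)) y ≤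
      3 / r * Real.exp (-1 * y) + 2 * (1 - Real.exp (-(1 / r) * y)) := by
  have hr0 : 0 < r := by linarith
  have hc := Real.exp_mul_le_add_of_mem_Icc (l := 1 / r) (by positivity)
    ((div_le_one hr0).2 hr) (-y)
  have e1 : -1 * y = -y := by ring
  have e2 : -(1 / r) * y = 1 / r * -y := by ring
  rw [e1, e2]
  have e3 : 3 / r * Real.exp (-y) = 3 * (1 / r * Real.exp (-y)) := by ring
  have hp : 0 < 1 / r * Real.exp (-y) := by positivity
  have hr' : 0 < 1 / r := by positivity
  by_cases hy : r < ‖y‖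
  · rw [Set.indicator_of_mem (by exact hy), e3]
    rw [Real.norm_eq_abs, lt_abs] at hy
    rcases hy with hy | hy
    · have h1 : Real.exp (1 / r * -y) ≤ Real.exp (-1) := by
        apply Real.exp_le_exp.2
        rw [one_div, inv_mul_le_iff₀ hr0]
        linarith
      have h2 : Real.exp (-1) < 1 / 2 := by
        have := Real.exp_neg_one_lt_d9
        linarith
      linarith
    · have h1 : 1 ≤ 1 / r * Real.exp (-y) := by
        rw [one_div, le_inv_mul_iff₀ hr0]
        have := Real.add_one_le_exp (-y)
        linarith
      linarith
  · rw [Set.indicator_of_notMem (by exact hy), e3]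
    linarith

/-- Probability measures whose Laplace transforms converge pointwise on `[0, ∞)` to a function
that is continuous at `0` form a tight sequence. -/
lemma isTightMeasureSet_range_of_tendsto_laplace
    {μs : ℕ → Measure ℝ} [∀ k, IsProbabilityMeasure (μs k)]
    {h : ℝ → ℝ} (hcont : ContinuousWithinAt h (Set.Ici 0) 0)
    (hint : ∀ l : ℝ, 0 ≤ l → ∀ k, Integrable (fun y => Real.exp (-l * y)) (μs k))
    (htend : ∀ l : ℝ, 0 ≤ l →
      Tendsto (fun k => ∫ y, Real.exp (-l * y) ∂(μs k)) atTop (nhds (h l))) :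
    IsTightMeasureSet (Set.range μs) := by
  apply isTightMeasureSet_range_of_tendsto_limsup_measure_norm_gt
  have h0 : h 0 = 1 := by
    refine tendsto_nhds_unique (htend 0 le_rfl) ?_
    simp
  have hB : Tendsto (fun r : ℝ => ENNReal.ofReal (3 / r * h 1 + 2 * (1 - h (1 / r))))
      atTop (nhds 0) := by
    have hinv : Tendsto (fun r : ℝ => 1 / r) atTop (nhdsWithin 0 (Set.Ici 0)) := by
      refine tendsto_nhdsWithin_iff.2 ⟨tendsto_const_nhds.div_atTop tendsto_id, ?_⟩
      filter_upwards [eventually_ge_atTop 0] with r hr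
      exact one_div_nonneg.2 hr
    have h2 : Tendsto (fun r : ℝ => h (1 / r)) atTop (nhds (h 0)) := hcont.tendsto.comp hinv
    have h3 : Tendsto (fun r : ℝ => 3 / r) atTop (nhds 0) :=
      tendsto_const_nhds.div_atTop tendsto_id
    have := ENNReal.tendsto_ofReal ((h3.mul_const (h 1)).add ((h2.const_sub 1).const_mul 2))
    simpa [h0] using this
  refine tendsto_of_tendsto_of_tendsto_of_le_of_le' tendsto_const_nhds hB
    (Eventually.of_forall fun _ => zero_le) ?_
  filter_upwards [eventually_ge_atTop 1] with r hr
  have hl : 0 ≤ 1 / r := by positivity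
  have hlim := ENNReal.tendsto_ofReal
    (((htend 1 zero_le_one).const_mul (3 / r)).add (((htend _ hl).const_sub 1).const_mul 2))
  rw [← hlim.limsup_eq]
  refine limsup_le_limsup (Eventually.of_forall fun k => ?_)
  have hS : MeasurableSet {x : ℝ | r < ‖x‖} := measurableSet_lt measurable_const measurable_norm
  have i1 := (hint 1 zero_le_one k).const_mul (3 / r)
  have i2 := ((integrable_const (1 : ℝ)).sub (hint _ hl k)).const_mul 2
  beta_reduce
  rw [← ofReal_measureReal]
  refine ENNReal.ofReal_le_ofReal ?_
  calc (μs k).real {x : ℝ | r < ‖x‖}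
      = ∫ y, Set.indicator {x : ℝ | r < ‖x‖} (fun _ => (1 : ℝ)) y ∂(μs k) := by
        rw [integral_indicator hS]; simp
    _ ≤ ∫ y, (3 / r * Real.exp (-1 * y) + 2 * (1 - Real.exp (-(1 / r) * y))) ∂(μs k) :=
        integral_mono ((integrable_const _).indicator hS) (i1.add i2)
          (indicator_lt_norm_le_exp hr)
    _ = _ := by
        have e := integral_add i1 i2
        simp only [Pi.sub_apply] at e
        rw [e, integral_const_mul, integral_const_mul,
          integral_sub (integrable_const _) (hint _ hl k)]
        simp

/-- If probability measures converge weakly and their Laplace transforms converge pointwise on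
`[0, ∞)`, then the limit of the transforms is the transform of the limit. -/
lemma laplace_eq_of_tendsto {ι : Type*} {F : Filter ι} [NeBot F]
    {P : ι → ProbabilityMeasure ℝ} {ν : ProbabilityMeasure ℝ} (hP : Tendsto P F (nhds ν))
    {h : ℝ → ℝ}
    (hint : ∀ l : ℝ, 0 ≤ l → ∀ k, Integrable (fun y => Real.exp (-l * y)) (P k : Measure ℝ))
    (htend : ∀ l : ℝ, 0 ≤ l →
      Tendsto (fun k => ∫ y, Real.exp (-l * y) ∂(P k : Measure ℝ)) F (nhds (h l)))
    {l : ℝ} (hl : 0 ≤ l) :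
    Integrable (fun y => Real.exp (-l * y)) (ν : Measure ℝ) ∧
      ∫ y, Real.exp (-l * y) ∂(ν : Measure ℝ) = h l := by
  set g : ℕ → ℝ → ℝ := fun n y => min (Real.exp (-l * y)) (n + 1) with hg
  have gcont (n) : Continuous (g n) := by simp only [hg]; fun_prop
  have gnonneg (n y) : 0 ≤ g n y := le_min (Real.exp_pos _).le (by positivity)
  have gbdd (n y) : ‖g n y‖ ≤ n + 1 := by
    rw [Real.norm_of_nonneg (gnonneg n y)]
    exact min_le_right _ _
  have gint (n) (ρ : Measure ℝ) [IsProbabilityMeasure ρ] : Integrable (g n) ρ :=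
    .of_bound (gcont n).aestronglyMeasurable _ (Eventually.of_forall (gbdd n))
  have glim (n) : Tendsto (fun k => ∫ y, g n y ∂(P k : Measure ℝ)) F
      (nhds (∫ y, g n y ∂(ν : Measure ℝ))) :=
    ProbabilityMeasure.tendsto_iff_forall_integral_tendsto.1 hP
      (BoundedContinuousFunction.ofNormedAddCommGroup (g n) (gcont n) _ (gbdd n))
  have hl2 : 0 ≤ 2 * l := by positivity
  have upper (n) : ∫ y, g n y ∂(ν : Measure ℝ) ≤ h l :=
    le_of_tendsto_of_tendsto' (glim n) (htend l hl) fun k =>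
      integral_mono (gint n _) (hint l hl k) fun y => min_le_left _ _
  have lower (n : ℕ) : h l - 1 / ((n : ℝ) + 1) * h (2 * l) ≤ ∫ y, g n y ∂(ν : Measure ℝ) := by
    refine le_of_tendsto_of_tendsto' ((htend l hl).sub ((htend _ hl2).const_mul _)) (glim n)
      fun k => ?_
    rw [← integral_const_mul, ← integral_sub (hint l hl k) ((hint _ hl2 k).const_mul _)]
    refine integral_mono ((hint l hl k).sub ((hint _ hl2 k).const_mul _)) (gint n _) fun y => ?_
    have e : Real.exp (-(2 * l) * y) = Real.exp (-l * y) * Real.exp (-l * y) := by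
      rw [← Real.exp_add]; ring_nf
    have hn : (0 : ℝ) < n + 1 := by positivity
    simp only [hg, e]
    set a := Real.exp (-l * y)
    have ha : 0 < a := Real.exp_pos _
    rw [one_div, inv_mul_eq_div, sub_le_iff_le_add]
    rcases le_total a (n + 1) with h' | h'
    · rw [min_eq_left h']
      have : 0 ≤ a * a / (n + 1) := by positivity
      linarith
    · have : a ≤ a * a / (n + 1) := by
        rw [le_div_iff₀ hn]
        gcongr
      rw [min_eq_right h']
      linarith
  have tend : Tendsto (fun n => ∫ y, g n y ∂(ν : Measure ℝ)) atTop (nhds (h l)) := by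
    refine tendsto_of_tendsto_of_tendsto_of_le_of_le ?_ tendsto_const_nhds lower upper
    simpa using (tendsto_one_div_add_atTop_nhds_zero_nat (𝕜 := ℝ)).mul_const (h (2 * l))
      |>.const_sub (h l)
  have gmono (y) : Monotone fun n => g n y := fun m n hmn => by
    simp only [hg]; gcongr
  have glimy (y) : Tendsto (fun n => g n y) atTop (nhds (Real.exp (-l * y))) := by
    refine tendsto_const_nhds.congr' ?_
    obtain ⟨N, hN⟩ := exists_nat_ge (Real.exp (-l * y))
    filter_upwards [eventually_ge_atTop N] with n hn
    have : (N : ℝ) ≤ n := by exact_mod_cast hn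
    exact (min_eq_left (by linarith)).symm
  have hlint : ∫⁻ y, ENNReal.ofReal (Real.exp (-l * y)) ∂(ν : Measure ℝ)
      = ENNReal.ofReal (h l) := by
    refine tendsto_nhds_unique (lintegral_tendsto_of_tendsto_of_monotone
      (f := fun n y => ENNReal.ofReal (g n y))
      (fun n => ((gcont n).measurable.ennreal_ofReal).aemeasurable)
      (Eventually.of_forall fun y m n hmn => ENNReal.ofReal_le_ofReal (gmono y hmn))
      (Eventually.of_forall fun y => ENNReal.tendsto_ofReal (glimy y))) ?_
    refine (ENNReal.tendsto_ofReal tend).congr fun n => ?_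
    exact ofReal_integral_eq_lintegral_ofReal (gint n _) (Eventually.of_forall (gnonneg n))
  have hmeas : AEStronglyMeasurable (fun y => Real.exp (-l * y)) (ν : Measure ℝ) := by
    fun_prop
  have hpos : 0 ≤ h l := ge_of_tendsto' (htend l hl) fun k => integral_nonneg fun y =>
    (Real.exp_pos _).le
  constructor
  · refine ⟨hmeas, ?_⟩
    rw [hasFiniteIntegral_iff_ofReal (Eventually.of_forall fun y => (Real.exp_pos _).le), hlint]
    exact ENNReal.ofReal_lt_top
  · rw [integral_eq_lintegral_of_nonneg_ae (Eventually.of_forall fun y => (Real.exp_pos _).le)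
      hmeas, hlint, ENNReal.toReal_ofReal hpos]

open ProbabilityTheory Complex in
/-- The characteristic function is the boundary value of the bilateral Laplace transform. -/
lemma tendsto_complexMGF_charFun {μ : Measure ℝ} [IsProbabilityMeasure μ]
    (hint : Integrable (fun y => Real.exp (-1 * y)) μ) (t : ℝ) :
    Tendsto (fun e : ℝ => complexMGF id μ (-e + t * I)) (nhdsWithin 0 (Set.Ioi 0))
      (nhds (charFun μ t)) := by
  rw [← complexMGF_id_mul_I]
  simp only [complexMGF, id]
  refine tendsto_integral_filter_of_dominated_convergence (fun y => Real.exp (-1 * y) + 1) ?_ ?_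
    (hint.add (integrable_const _)) ?_
  · exact Eventually.of_forall fun e => by fun_prop
  · filter_upwards [Ioo_mem_nhdsGT (zero_lt_one (α := ℝ))] with e he
    refine Eventually.of_forall fun y => ?_
    rw [norm_exp]
    have := Real.exp_mul_le_add_of_mem_Icc he.1.le he.2.le (-y)
    have e1 : ((-e + t * I) * y : ℂ).re = e * -y := by simp
    rw [e1, neg_one_mul]
    nlinarith [he.1, he.2, Real.exp_pos (-y)]
  · refine Eventually.of_forall fun y => ?_
    have : Continuous fun e : ℝ => cexp ((-e + t * I) * y) := by fun_prop
    have := (this.tendsto 0).mono_left (nhdsWithin_le_nhds (s := Set.Ioi 0))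
    simpa using this

open ProbabilityTheory Complex in
/-- A probability measure on `ℝ` whose Laplace transform is finite on `[0, ∞)` is determined by
its Laplace transform there. -/
lemma MeasureTheory.Measure.ext_of_laplace_eq {μ ν : Measure ℝ} [IsProbabilityMeasure μ]
    [IsProbabilityMeasure ν]
    (hμ : ∀ l : ℝ, 0 ≤ l → Integrable (fun y => Real.exp (-l * y)) μ)
    (hν : ∀ l : ℝ, 0 ≤ l → Integrable (fun y => Real.exp (-l * y)) ν)
    (heq : ∀ l : ℝ, 0 ≤ l → ∫ y, Real.exp (-l * y) ∂μ = ∫ y, Real.exp (-l * y) ∂ν) :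
    μ = ν := by
  have analytic {ρ : Measure ℝ} (hρ : ∀ l : ℝ, 0 ≤ l → Integrable (fun y => Real.exp (-l * y)) ρ) :
      AnalyticOnNhd ℂ (complexMGF id ρ) {z | z.re < 0} := by
    refine analyticOnNhd_complexMGF.mono fun z hz => ?_
    refine interior_maximal (t := Set.Iio 0) (fun s hs => ?_) isOpen_Iio hz
    simpa [integrableExpSet] using hρ (-s) (by simpa using (Set.mem_Iio.1 hs).le)
  have hconv : IsPreconnected {z : ℂ | z.re < 0} :=
    (convex_halfSpace_re_lt 0).isPreconnected
  have hEq : Set.EqOn (complexMGF id μ) (complexMGF id ν) {z | z.re < 0} := by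
    refine (analytic hμ).eqOn_of_preconnected_of_frequently_eq (analytic hν) hconv
      (z₀ := ((-1 : ℝ) : ℂ)) (by simp) ?_
    have hreal : ∃ᶠ x : ℝ in nhdsWithin (-1) {-1}ᶜ,
        complexMGF id μ x = complexMGF id ν x := by
      refine Eventually.frequently ?_
      filter_upwards [nhdsWithin_le_nhds (Iio_mem_nhds (show (-1 : ℝ) < 0 by norm_num))] with x hx
      have := heq (-x) (by simpa using (Set.mem_Iio.1 hx).le)
      simp only [neg_neg] at this
      simp only [complexMGF_ofReal, mgf, id, this]
    have hmap : Tendsto (fun x : ℝ => (x : ℂ)) (nhdsWithin (-1) {-1}ᶜ)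
        (nhdsWithin ((-1 : ℝ) : ℂ) {((-1 : ℝ) : ℂ)}ᶜ) :=
      continuous_ofReal.continuousAt.continuousWithinAt.tendsto_nhdsWithin fun x hx => by
        simpa only [Set.mem_compl_iff, Set.mem_singleton_iff, ofReal_inj] using hx
    exact hmap.frequently hreal
  refine Measure.ext_of_charFun (funext fun t => ?_)
  refine tendsto_nhds_unique (tendsto_complexMGF_charFun (hμ 1 zero_le_one) t)
    ((tendsto_complexMGF_charFun (hν 1 zero_le_one) t).congr' ?_)
  filter_upwards [self_mem_nhdsWithin] with e he
  exact (hEq (by simpa using he)).symm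

/-- Laplace-transform continuity theorem: if Borel probability measures
`μ k` on `ℝ` have Laplace transforms converging pointwise on `[0, ∞)` to a continuous
function `h`, then there is a unique Borel probability measure `μ` whose Laplace transform
is `h`, and `μ k` converges weakly to `μ`. -/
theorem laplace_continuity_theorem
    (μs : ℕ → Measure ℝ) (hprob : ∀ k, IsProbabilityMeasure (μs k))
    (h : ℝ → ℝ) (hcont : ContinuousOn h (Set.Ici 0))
    (hint : ∀ l : ℝ, 0 ≤ l → ∀ k, Integrable (fun y => Real.exp (-l * y)) (μs k))
    (htend : ∀ l : ℝ, 0 ≤ l →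
      Tendsto (fun k => ∫ y, Real.exp (-l * y) ∂(μs k)) atTop (nhds (h l))) :
    ∃ μ : Measure ℝ, IsProbabilityMeasure μ ∧
      (∀ l : ℝ, 0 ≤ l → Integrable (fun y => Real.exp (-l * y)) μ ∧
        ∫ y, Real.exp (-l * y) ∂μ = h l) ∧
      (∀ ν : Measure ℝ, IsProbabilityMeasure ν →
        (∀ l : ℝ, 0 ≤ l → Integrable (fun y => Real.exp (-l * y)) ν ∧
          ∫ y, Real.exp (-l * y) ∂ν = h l) → ν = μ) ∧
      (∀ f : ℝ → ℝ, Continuous f → (∃ M : ℝ, ∀ y, |f y| ≤ M) →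
        Tendsto (fun k => ∫ y, f y ∂(μs k)) atTop (nhds (∫ y, f y ∂μ))) := by
  let P : ℕ → ProbabilityMeasure ℝ := fun k => ⟨μs k, hprob k⟩
  have htight := isTightMeasureSet_range_of_tendsto_laplace
    (hcont 0 Set.self_mem_Ici) hint htend
  have hK : IsCompact (closure (Set.range P)) := by
    refine isCompact_closure_of_isTightMeasureSet (htight.subset ?_)
    rintro _ ⟨_, ⟨k, rfl⟩, rfl⟩
    exact ⟨k, rfl⟩
  have hmem : ∀ᶠ k in atTop, P k ∈ closure (Set.range P) :=
    Eventually.of_forall fun k => subset_closure ⟨k, rfl⟩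
  have hcluster (ν : ProbabilityMeasure ℝ) (hν : MapClusterPt ν atTop P) (l : ℝ) (hl : 0 ≤ l) :
      Integrable (fun y => Real.exp (-l * y)) (ν : Measure ℝ) ∧
        ∫ y, Real.exp (-l * y) ∂(ν : Measure ℝ) = h l := by
    obtain ⟨U, hU, hUν⟩ := mapClusterPt_iff_ultrafilter.1 hν
    exact laplace_eq_of_tendsto hUν hint (fun l hl => (htend l hl).mono_left hU) hl
  obtain ⟨μ, -, hμ⟩ := hK.exists_mapClusterPt (f := atTop) (u := P) (by simpa using hmem)
  have huniq (ν : Measure ℝ) (hν : IsProbabilityMeasure ν)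
      (hL : ∀ l : ℝ, 0 ≤ l → Integrable (fun y => Real.exp (-l * y)) ν ∧
        ∫ y, Real.exp (-l * y) ∂ν = h l) : ν = (μ : Measure ℝ) :=
    Measure.ext_of_laplace_eq (fun l hl => (hL l hl).1) (fun l hl => (hcluster μ hμ l hl).1)
      fun l hl => (hL l hl).2.trans (hcluster μ hμ l hl).2.symm
  have hlim : Tendsto P atTop (nhds μ) :=
    hK.tendsto_nhds_of_unique_mapClusterPt hmem fun ν _ hν =>
      Subtype.ext (huniq ν inferInstance (hcluster ν hν))
  refine ⟨μ, inferInstance, hcluster μ hμ, huniq, fun f hf ⟨M, hM⟩ => ?_⟩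
  exact ProbabilityMeasure.tendsto_iff_forall_integral_tendsto.1 hlim
    (BoundedContinuousFunction.ofNormedAddCommGroup f hf M hM)
end

section
/- Let X and Y be independent, identically distributed real random variables on a probability space such that X − Y has the Gaussian distribution with mean 0 and variance 2. Then there exists μ ∈ ℝ such that X has the Gaussian distribution with mean μ and variance 1. -/
open MeasureTheory ProbabilityTheory

/-- A nowhere vanishing entire function has an entire logarithm vanishing at the origin. -/
lemma exists_entire_log {F : ℂ → ℂ} (hF : Differentiable ℂ F) (hF0 : ∀ z, F z ≠ 0)
    (hF1 : F 0 = 1) :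
    ∃ g : ℂ → ℂ, Differentiable ℂ g ∧ g 0 = 0 ∧ ∀ z, F z = Complex.exp (g z) := by
  have hdF : Differentiable ℂ (deriv F) := hF.deriv
  obtain ⟨G, hG⟩ := (hdF.div hF hF0).isExactOn_univ
  have hG' : ∀ z, HasDerivAt G (deriv F z / F z) z := fun z => hG z trivial
  have hconst : ∀ z, F z * Complex.exp (-G z) = F 0 * Complex.exp (-G 0) := by
    have hd : ∀ z, HasDerivAt (fun z => F z * Complex.exp (-G z)) 0 z := by
      intro z
      refine ((hF z).hasDerivAt.mul (hG' z).neg.cexp).congr_deriv ?_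
      have := hF0 z
      simp only [Pi.neg_apply]
      field_simp
      ring
    exact fun z => is_const_of_deriv_eq_zero (fun z => (hd z).differentiableAt)
      (fun z => (hd z).deriv) z 0
  refine ⟨fun z => G z - G 0, fun z => (hG' z).differentiableAt.sub_const _, by simp,
    fun z => ?_⟩
  have h := hconst z
  rw [hF1, one_mul] at h
  change F z = Complex.exp (G z - G 0)
  rw [sub_eq_add_neg, Complex.exp_add, ← h, mul_left_comm, ← Complex.exp_add]
  simp

/-- An entire function vanishing at the origin whose real part grows at most quadratically is a
polynomial of degree at most two. -/
lemma eq_quadratic_of_re_le {f : ℂ → ℂ} (hf : Differentiable ℂ f) (hf0 : f 0 = 0) {A : ℝ}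
    (hA : 0 < A) (hre : ∀ z, (f z).re ≤ A * (1 + ‖z‖ ^ 2)) :
    ∃ a b : ℂ, ∀ z, f z = a * z ^ 2 + b * z := by
  have hnorm : ∀ z, ‖f z‖ ≤ 2 * (A * (1 + (2 * ‖z‖) ^ 2)) := by
    intro z
    rcases eq_or_ne z 0 with rfl | hz
    · rw [hf0, norm_zero]; positivity
    have hz' : 0 < ‖z‖ := norm_pos_iff.2 hz
    have h := Complex.borelCaratheodory_zero (M := A * (1 + (2 * ‖z‖) ^ 2)) (R := 2 * ‖z‖) (z := z)
      (by positivity) hf.differentiableOn (fun w hw => ?_) (by positivity)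
      (by simpa using by linarith) hf0
    · refine h.trans_eq ?_
      field_simp
      ring
    · have hw' : ‖w‖ ≤ 2 * ‖z‖ := (mem_ball_zero_iff.1 hw).le
      refine (hre w).trans ?_
      gcongr
  have hf1 : Differentiable ℂ (deriv f) := hf.deriv
  have hf2 : Differentiable ℂ (deriv (deriv f)) := hf1.deriv
  have hbound : ∀ c, ‖deriv (deriv f) c‖ ≤ 68 * A := by
    intro c
    have hR : 0 < ‖c‖ + 1 := by positivity
    have h := Complex.norm_iteratedDeriv_le_of_forall_mem_sphere_norm_le (c := c) (R := ‖c‖ + 1)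
      (C := 34 * A * (‖c‖ + 1) ^ 2) 2 hR hf.diffContOnCl (fun z hz => ?_)
    · rw [iteratedDeriv_succ, iteratedDeriv_one] at h
      refine h.trans_eq ?_
      rw [Nat.factorial_two]
      push_cast
      field_simp
      norm_num
    · have hz' : ‖z‖ ≤ 2 * (‖c‖ + 1) := by
        have h1 : ‖z - c‖ = ‖c‖ + 1 := by simpa [dist_eq_norm] using hz
        have h2 := norm_add_le (z - c) c
        rw [sub_add_cancel] at h2
        linarith
      calc ‖f z‖ ≤ 2 * (A * (1 + (2 * ‖z‖) ^ 2)) := hnorm z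
        _ ≤ 2 * (A * (1 + (2 * (2 * (‖c‖ + 1))) ^ 2)) := by gcongr
        _ ≤ 34 * A * (‖c‖ + 1) ^ 2 := by
          nlinarith [norm_nonneg c, mul_nonneg hA.le (norm_nonneg c),
            mul_nonneg hA.le (sq_nonneg ‖c‖)]
  have hc2 : ∀ z, deriv (deriv f) z = deriv (deriv f) 0 := fun z =>
    hf2.apply_eq_apply_of_bounded
      (isBounded_iff_forall_norm_le.2 ⟨68 * A, by rintro _ ⟨w, rfl⟩; exact hbound w⟩) z 0
  set a := deriv (deriv f) 0
  have hc1 : ∀ z, deriv f z = a * z + deriv f 0 := by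
    have hd : ∀ z, HasDerivAt (fun z => deriv f z - a * z) 0 z := by
      intro z
      have h := (hf1 z).hasDerivAt.sub ((hasDerivAt_id z).const_mul a)
      rw [hc2 z, mul_one, sub_self] at h
      exact h
    intro z
    have := is_const_of_deriv_eq_zero (fun z => (hd z).differentiableAt) (fun z => (hd z).deriv) z 0
    linear_combination this
  refine ⟨a / 2, deriv f 0, fun z => ?_⟩
  have hd : ∀ z, HasDerivAt (fun z => f z - (a / 2 * z ^ 2 + deriv f 0 * z)) 0 z := by
    intro z
    refine ((hf z).hasDerivAt.sub ((((hasDerivAt_id z).pow 2).const_mul (a / 2)).add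
      ((hasDerivAt_id z).const_mul (deriv f 0)))).congr_deriv ?_
    rw [hc1 z]
    simp
    ring
  have := is_const_of_deriv_eq_zero (fun z => (hd z).differentiableAt) (fun z => (hd z).deriv) z 0
  simp only [hf0] at this
  linear_combination this

/-- If a difference of independent variables has a finite exponential moment, so does the minuend. -/
lemma integrable_exp_mul_of_indepFun_sub {Ω : Type*} [MeasurableSpace Ω] {μ : Measure Ω}
    [IsProbabilityMeasure μ] {X Y : Ω → ℝ} (hX : Measurable X) (hY : Measurable Y)
    (hindep : IndepFun X Y μ) {t : ℝ}
    (h : Integrable (fun ω => Real.exp (t * (X ω - Y ω))) μ) :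
    Integrable (fun ω => Real.exp (t * X ω)) μ := by
  have hi : IndepFun (fun ω => Real.exp (t * X ω)) (fun ω => Real.exp (-t * Y ω)) μ :=
    hindep.comp (φ := fun x => Real.exp (t * x)) (ψ := fun y => Real.exp (-t * y))
      (by fun_prop) (by fun_prop)
  refine hi.integrable_left_of_integrable_op (fun x y => x * y) 1 one_ne_zero ?_ ?_ ?_ ?_ ?_
  · intro x y; simp
  · convert h using 2 with ω
    rw [← Real.exp_add]; ring_nf
  · fun_prop
  · fun_prop
  · intro h0
    obtain ⟨ω, hω⟩ := h0.exists
    exact (Real.exp_pos _).ne' hω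

/-- The complex moment generating function of a difference of independent variables. -/
lemma complexMGF_sub_of_indepFun {Ω : Type*} [MeasurableSpace Ω] {μ : Measure Ω}
    {X Y : Ω → ℝ} (hX : Measurable X) (hY : Measurable Y)
    (hindep : IndepFun X Y μ) (z : ℂ) :
    complexMGF (fun ω => X ω - Y ω) μ z = complexMGF X μ z * complexMGF Y μ (-z) := by
  have hi : IndepFun (fun ω => Complex.exp (z * X ω)) (fun ω => Complex.exp (-z * Y ω)) μ :=
    hindep.comp (φ := fun x : ℝ => Complex.exp (z * x)) (ψ := fun y : ℝ => Complex.exp (-z * y))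
      (by fun_prop) (by fun_prop)
  rw [complexMGF, complexMGF, complexMGF,
    ← hi.integral_fun_mul_eq_mul_integral (by fun_prop) (by fun_prop)]
  congr with ω
  rw [← Complex.exp_add]
  push_cast
  ring_nf

/-- Jensen's inequality for the moment generating function. -/
lemma exp_mul_integral_le_mgf {Ω : Type*} [MeasurableSpace Ω] {μ : Measure Ω}
    [IsProbabilityMeasure μ] {X : Ω → ℝ} (hX : Integrable X μ) {t : ℝ}
    (ht : Integrable (fun ω => Real.exp (t * X ω)) μ) :
    Real.exp (t * ∫ ω, X ω ∂μ) ≤ mgf X μ t := by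
  have h := convexOn_exp.map_integral_le (μ := μ) (f := fun ω => t * X ω)
    Real.continuous_exp.continuousOn isClosed_univ (by simp) (hX.const_mul t) ht
  rwa [integral_const_mul] at h

/-- If `X` and `Y` are independent, identically distributed real random
variables and `X − Y` is Gaussian with mean `0` and variance `2`, then `X` is Gaussian with
some mean `m` and variance `1`. -/
theorem gaussian_of_diff_gaussian
    {Ω : Type*} [MeasurableSpace Ω] (μ : Measure Ω) [IsProbabilityMeasure μ]
    (X Y : Ω → ℝ) (hX : Measurable X) (hY : Measurable Y)
    (hindep : IndepFun X Y μ) (hid : IdentDistrib X Y μ μ)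
    (hdiff : μ.map (fun ω => X ω - Y ω) = gaussianReal 0 2) :
    ∃ m : ℝ, μ.map X = gaussianReal m 1 := by
  have hint : ∀ t : ℝ, Integrable (fun ω => Real.exp (t * X ω)) μ := by
    intro t
    refine integrable_exp_mul_of_indepFun_sub hX hY hindep ?_
    have h := integrable_exp_mul_gaussianReal (μ := 0) (v := 2) t
    rw [← hdiff] at h
    exact h.comp_measurable (hX.sub hY)
  have hset : integrableExpSet X μ = Set.univ := Set.eq_univ_of_forall hint
  have hmem : ∀ t : ℝ, t ∈ interior (integrableExpSet X μ) := by simp [hset]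
  have hXint : Integrable X μ := by
    simpa using integrable_pow_of_mem_interior_integrableExpSet (hmem 0) 1
  have hFd : Differentiable ℂ (complexMGF X μ) := fun z =>
    (hasDerivAt_complexMGF (hmem _)).differentiableAt
  have hmul : ∀ z, complexMGF X μ z * complexMGF X μ (-z) = Complex.exp (z ^ 2) := by
    intro z
    have h := complexMGF_sub_of_indepFun hX hY hindep z
    rw [complexMGF_gaussianReal hdiff, ← complexMGF_congr_identDistrib hid] at h
    rw [← h]
    congr 1
    simp
  have hF1 : complexMGF X μ 0 = 1 := by simp [complexMGF]
  obtain ⟨g, hg, hg0, hFg⟩ := exists_entire_log hFd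
    (fun z h0 => Complex.exp_ne_zero (z ^ 2) (by rw [← hmul z, h0, zero_mul])) hF1
  set m := ∫ ω, X ω ∂μ with hm
  have hmgf : ∀ x : ℝ, mgf X μ x ≤ Real.exp (x ^ 2 + m * x) := by
    intro x
    have h1 : mgf X μ x * mgf X μ (-x) = Real.exp (x ^ 2) := by
      have h := hmul x
      rw [← Complex.ofReal_neg, complexMGF_ofReal, complexMGF_ofReal] at h
      exact_mod_cast h
    have h2 := exp_mul_integral_le_mgf hXint (hint (-x))
    have h3 : mgf X μ x * Real.exp (-x * m) ≤ Real.exp (x ^ 2) := by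
      rw [← h1]
      exact mul_le_mul_of_nonneg_left h2 mgf_nonneg
    rw [← le_div_iff₀ (Real.exp_pos _), ← Real.exp_sub] at h3
    refine h3.trans_eq ?_
    congr 1
    ring
  have hre : ∀ z, (g z).re ≤ (1 + |m|) * (1 + ‖z‖ ^ 2) := by
    intro z
    have h := (norm_complexMGF_le_mgf (X := X) (μ := μ) (z := z)).trans (hmgf z.re)
    rw [hFg, Complex.norm_exp, Real.exp_le_exp] at h
    have h1 := Complex.abs_re_le_norm z
    have h2 : m * z.re ≤ |m| * ‖z‖ := by
      refine (le_abs_self _).trans ?_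
      rw [abs_mul]
      gcongr
    have h3 : z.re ^ 2 ≤ ‖z‖ ^ 2 := by
      rw [← sq_abs]
      gcongr
    nlinarith [abs_nonneg m, mul_nonneg (abs_nonneg m) (sq_nonneg (‖z‖ - 1)),
      mul_nonneg (abs_nonneg m) (sq_nonneg ‖z‖)]
  obtain ⟨a, b, hab⟩ := eq_quadratic_of_re_le hg hg0 (by positivity) hre
  have ha : a = 1 / 2 := by
    have hone : ∀ w : ℂ, Complex.exp ((2 * a - 1) * w) = 1 := by
      intro w
      obtain ⟨z, rfl⟩ := IsAlgClosed.exists_pow_nat_eq w two_pos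
      have h := hmul z
      rw [hFg, hFg, ← Complex.exp_add, hab, hab] at h
      rw [sub_mul, Complex.exp_sub, one_mul, ← h, ← Complex.exp_sub]
      ring_nf
      simp
    have hd : HasDerivAt (fun w : ℂ => Complex.exp ((2 * a - 1) * w)) (2 * a - 1) 0 := by
      simpa using ((hasDerivAt_id (0 : ℂ)).const_mul (2 * a - 1)).cexp
    have h0 : HasDerivAt (fun w : ℂ => Complex.exp ((2 * a - 1) * w)) 0 0 := by
      simp_rw [hone]
      exact hasDerivAt_const _ _
    linear_combination (hd.unique h0) / 2
  have hF : ∀ z, complexMGF X μ z = Complex.exp (z ^ 2 / 2 + b * z) := by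
    intro z
    rw [hFg, hab, ha]
    ring_nf
  have hb : b = m := by
    have h1 : HasDerivAt (complexMGF X μ) m 0 := by
      have h := hasDerivAt_complexMGF (X := X) (μ := μ) (z := 0) (hmem _)
      simpa [hm, integral_complex_ofReal] using h
    have h2 : HasDerivAt (complexMGF X μ) b 0 := by
      rw [funext hF]
      have h := ((((hasDerivAt_id (0 : ℂ)).pow 2).div_const 2).add
        ((hasDerivAt_id (0 : ℂ)).const_mul b)).cexp
      simpa using h
    exact h2.unique h1
  refine ⟨m, Measure.ext_of_complexMGF_id_eq ?_⟩
  ext z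
  rw [complexMGF_id_map hX.aemeasurable, hF, complexMGF_id_gaussianReal, hb]
  congr 1
  simp
  ring
end
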